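/- arXiv:0911.1300 — 2 statements merged into one kernel-verified Lean document; each statement's English description precedes it below -/
import Mathlib

section
/- Let (G, d) be a normed groupoid. The following two conditions are equivalent: (3) for every net of arrows (a_ε), if (a_ε) simply converges to a and simply converges to b then a = b; (4) for every net of arrows (a_ε), if (a_ε) right-converges to a and left-converges to b then a = b. Moreover, each of these conditions implies that the norm d is separable. -/
/-- A groupoid given by its set of objects `X` and set of arrows `G`, with
source `src`, target `tgt`, identity section `unit`, a (total) composition
`comp` whose value is only meaningful when `src g = tgt h`, and inversion
`inv`. -/
structure GroupoidStr (X : Type*) (G : Type*) where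
  src : G → X
  tgt : G → X
  unit : X → G
  comp : G → G → G
  inv : G → G
  src_unit : ∀ x, src (unit x) = x
  tgt_unit : ∀ x, tgt (unit x) = x
  src_comp : ∀ g h, src g = tgt h → src (comp g h) = src h
  tgt_comp : ∀ g h, src g = tgt h → tgt (comp g h) = tgt g
  comp_assoc : ∀ g h k, src g = tgt h → src h = tgt k →
    comp (comp g h) k = comp g (comp h k)
  unit_comp : ∀ g, comp (unit (tgt g)) g = g
  comp_unit : ∀ g, comp g (unit (src g)) = g
  src_inv : ∀ g, src (inv g) = tgt g
  tgt_inv : ∀ g, tgt (inv g) = src g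
  inv_comp : ∀ g, comp (inv g) g = unit (src g)
  comp_inv : ∀ g, comp g (inv g) = unit (tgt g)

/-- `d` is a norm on the groupoid `S`. -/
structure IsGroupoidNorm {X G : Type*} (S : GroupoidStr X G) (d : G → ℝ) : Prop where
  nonneg : ∀ g, 0 ≤ d g
  eq_zero_iff : ∀ g, (d g = 0 ↔ ∃ x, g = S.unit x)
  comp_le : ∀ g h, S.src g = S.tgt h → d (S.comp g h) ≤ d g + d h
  inv_eq : ∀ g, d (S.inv g) = d g

/-- The net `a` left-converges to `b`. -/
def LeftConv {X G ι : Type*} [Preorder ι] (S : GroupoidStr X G) (d : G → ℝ)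
    (a : ι → G) (b : G) : Prop :=
  (∀ i, S.tgt (a i) = S.tgt b) ∧
    Filter.Tendsto (fun i => d (S.comp (S.inv (a i)) b)) Filter.atTop (nhds 0)

/-- The net `a` right-converges to `b`. -/
def RightConv {X G ι : Type*} [Preorder ι] (S : GroupoidStr X G) (d : G → ℝ)
    (a : ι → G) (b : G) : Prop :=
  (∀ i, S.src (a i) = S.src b) ∧
    Filter.Tendsto (fun i => d (S.comp (a i) (S.inv b))) Filter.atTop (nhds 0)

/-- The net `a` simply converges to `b`: there are nets `g`, `h` such that
`h i * a i * g i` is defined, equals `b`, and `d (g i) + d (h i) → 0`. -/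
def SimpleConv {X G ι : Type*} [Preorder ι] (S : GroupoidStr X G) (d : G → ℝ)
    (a : ι → G) (b : G) : Prop :=
  ∃ g h : ι → G,
    (∀ i, S.src (h i) = S.tgt (a i)) ∧
    (∀ i, S.src (a i) = S.tgt (g i)) ∧
    (∀ i, S.comp (S.comp (h i) (a i)) (g i) = b) ∧
    Filter.Tendsto (fun i => d (g i) + d (h i)) Filter.atTop (nhds 0)

/-- The norm `d` is separable: any net of arrows with constant source `x` and
constant target `y` whose norms tend to `0` forces `x = y`. -/
def SeparableNorm {X G : Type*} (S : GroupoidStr X G) (d : G → ℝ) : Prop :=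
  ∀ (ι : Type) [Nonempty ι] [SemilatticeSup ι] (a : ι → G) (x y : X),
    (∀ i, S.src (a i) = x) → (∀ i, S.tgt (a i) = y) →
    Filter.Tendsto (fun i => d (a i)) Filter.atTop (nhds 0) → x = y

namespace GroupoidStr

variable {X G : Type*} (S : GroupoidStr X G)

theorem inv_comp_cancel_left {g h : G} (e : S.src g = S.tgt h) :
    S.comp (S.inv g) (S.comp g h) = h := by
  rw [← S.comp_assoc _ _ _ (S.src_inv g) e, S.inv_comp, e, S.unit_comp]

theorem comp_inv_cancel_left {g h : G} (e : S.tgt g = S.tgt h) :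
    S.comp g (S.comp (S.inv g) h) = h := by
  rw [← S.comp_assoc _ _ _ (S.tgt_inv g).symm ((S.src_inv g).trans e), S.comp_inv, e,
    S.unit_comp]

theorem comp_inv_cancel_right {g h : G} (e : S.src g = S.tgt h) :
    S.comp (S.comp g h) (S.inv h) = g := by
  rw [S.comp_assoc _ _ _ e (S.tgt_inv h).symm, S.comp_inv, ← e, S.comp_unit]

theorem inv_comp_cancel_right {g h : G} (e : S.src g = S.src h) :
    S.comp (S.comp g (S.inv h)) h = g := by
  rw [S.comp_assoc _ _ _ (e.trans (S.tgt_inv h).symm) (S.src_inv h), S.inv_comp, ← e, S.comp_unit]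

theorem comp_comp_inv_comp {g h k : G} (e : S.src g = S.tgt k) (f : S.src h = S.tgt k) :
    S.comp (S.comp g k) (S.inv (S.comp h k)) = S.comp g (S.inv h) := by
  have hgh : S.src g = S.tgt (S.inv h) := by rw [S.tgt_inv, e, f]
  have hhk : S.src (S.inv h) = S.tgt (S.comp h k) := by rw [S.src_inv, S.tgt_comp _ _ f]
  have key : S.comp g k = S.comp (S.comp g (S.inv h)) (S.comp h k) := by
    rw [S.comp_assoc _ _ _ hgh hhk, S.inv_comp_cancel_left f]
  rw [key, S.comp_inv_cancel_right (by rw [S.src_comp _ _ hgh, hhk])]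

theorem inv_comp_comp_comp {g h k : G} (e : S.src k = S.tgt g) (f : S.src k = S.tgt h) :
    S.comp (S.inv (S.comp k g)) (S.comp k h) = S.comp (S.inv g) h := by
  have hgh : S.src (S.inv g) = S.tgt h := by rw [S.src_inv, ← e, f]
  have hg : S.src g = S.tgt (S.comp (S.inv g) h) := by rw [S.tgt_comp _ _ hgh, S.tgt_inv]
  have key : S.comp k h = S.comp (S.comp k g) (S.comp (S.inv g) h) := by
    rw [S.comp_assoc _ _ _ e hg, S.comp_inv_cancel_left (e.symm.trans f)]
  rw [key, S.inv_comp_cancel_left (by rw [S.src_comp _ _ e, hg])]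

end GroupoidStr

section NormedGroupoid

variable {X G ι : Type*} [Preorder ι] {S : GroupoidStr X G} {d : G → ℝ} {a : ι → G} {b c : G}

theorem IsGroupoidNorm.unit_eq_zero (hd : IsGroupoidNorm S d) (x : X) : d (S.unit x) = 0 :=
  (hd.eq_zero_iff _).2 ⟨x, rfl⟩

theorem RightConv.simpleConv (hd : IsGroupoidNorm S d) (h : RightConv S d a b) :
    SimpleConv S d a b := by
  obtain ⟨hs, ht⟩ := h
  have hab (i : ι) : S.src (a i) = S.tgt (S.inv b) := by rw [S.tgt_inv, hs]
  have key (i : ι) : S.comp (S.inv (S.comp (a i) (S.inv b))) (a i) = b := by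
    nth_rw 2 [← S.inv_comp_cancel_right (hs i)]
    exact S.inv_comp_cancel_left (by rw [S.src_comp _ _ (hab i), S.src_inv])
  refine ⟨fun i => S.unit (S.src (a i)), fun i => S.inv (S.comp (a i) (S.inv b)),
    fun i => ?_, fun i => (S.tgt_unit _).symm, fun i => ?_, ?_⟩
  · rw [S.src_inv, S.tgt_comp _ _ (hab i)]
  · simp only [key, hs, S.comp_unit]
  · simpa only [hd.unit_eq_zero, hd.inv_eq, zero_add] using ht

theorem LeftConv.simpleConv (hd : IsGroupoidNorm S d) (h : LeftConv S d a b) :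
    SimpleConv S d a b := by
  obtain ⟨hs, ht⟩ := h
  refine ⟨fun i => S.comp (S.inv (a i)) b, fun i => S.unit (S.tgt (a i)),
    fun i => S.src_unit _, fun i => ?_, fun i => ?_, ?_⟩
  · rw [S.tgt_comp _ _ (by rw [S.src_inv, hs]), S.tgt_inv]
  · rw [S.unit_comp, S.comp_inv_cancel_left (hs i)]
  · simpa only [hd.unit_eq_zero, add_zero] using ht

/-- Two simple limits of one net are the right limit and the left limit of another net. -/
theorem SimpleConv.exists_rightConv_leftConv (hd : IsGroupoidNorm S d)
    (hb : SimpleConv S d a b) (hc : SimpleConv S d a c) :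
    ∃ n : ι → G, RightConv S d n b ∧ LeftConv S d n c := by
  obtain ⟨g, h, hh, hg, hbe, ht⟩ := hb
  obtain ⟨g', h', hh', hg', hce, ht'⟩ := hc
  have hag (i : ι) : S.tgt (S.comp (a i) (g i)) = S.tgt (a i) := S.tgt_comp _ _ (hg i)
  have hag' (i : ι) : S.src (S.comp (h' i) (a i)) = S.src (a i) := S.src_comp _ _ (hh' i)
  have hsum := ht.add ht'
  rw [add_zero] at hsum
  refine ⟨fun i => S.comp (S.comp (h' i) (a i)) (g i), ⟨fun i => ?_, ?_⟩, ⟨fun i => ?_, ?_⟩⟩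
  · rw [← hbe i, S.src_comp _ _ ((hag' i).trans (hg i)),
      S.src_comp _ _ ((S.src_comp _ _ (hh i)).trans (hg i))]
  · refine squeeze_zero (fun i => hd.nonneg _) (fun i => ?_) hsum
    have hle := hd.comp_le (h' i) (S.inv (h i)) (by rw [S.tgt_inv, hh, hh'])
    rw [hd.inv_eq] at hle
    beta_reduce
    rw [← hbe i, S.comp_assoc _ _ _ (hh' i) (hg i), S.comp_assoc _ _ _ (hh i) (hg i),
      S.comp_comp_inv_comp (by rw [hag, hh']) (by rw [hag, hh])]
    linarith [hd.nonneg (g i), hd.nonneg (g' i)]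
  · rw [← hce i, S.tgt_comp _ _ ((hag' i).trans (hg i)), S.tgt_comp _ _ ((hag' i).trans (hg' i))]
  · refine squeeze_zero (fun i => hd.nonneg _) (fun i => ?_) hsum
    have hle := hd.comp_le (S.inv (g i)) (g' i) (by rw [S.src_inv, ← hg, hg'])
    rw [hd.inv_eq] at hle
    rw [← hce i, S.inv_comp_comp_comp ((hag' i).trans (hg i)) ((hag' i).trans (hg' i))]
    linarith [hd.nonneg (h i), hd.nonneg (h' i)]

theorem rightConv_unit {x : X} (hs : ∀ i, S.src (a i) = x)
    (ht : Filter.Tendsto (fun i => d (a i)) Filter.atTop (nhds 0)) :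
    RightConv S d a (S.unit x) := by
  have key (i : ι) : S.comp (a i) (S.inv (S.unit x)) = a i := by
    have h := S.comp_inv_cancel_right (g := a i) (h := S.unit x) (by rw [S.tgt_unit, hs])
    rwa [← hs i, S.comp_unit, hs i] at h
  refine ⟨fun i => by rw [S.src_unit, hs], ?_⟩
  simpa only [key] using ht

theorem leftConv_unit (hd : IsGroupoidNorm S d) {y : X} (hs : ∀ i, S.tgt (a i) = y)
    (ht : Filter.Tendsto (fun i => d (a i)) Filter.atTop (nhds 0)) :
    LeftConv S d a (S.unit y) := by
  have key (i : ι) : S.comp (S.inv (a i)) (S.unit y) = S.inv (a i) := by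
    rw [← hs i, ← S.src_inv, S.comp_unit]
  refine ⟨fun i => by rw [S.tgt_unit, hs], ?_⟩
  simpa only [key, hd.inv_eq] using ht

end NormedGroupoid

/-- Conditions (3) (uniqueness of simple limits of nets) and (4) (a net cannot
right-converge to `b` and left-converge to `c` unless `b = c`) are equivalent,
and each of them implies that the norm is separable. -/
theorem simpleConv_unique_iff_right_left_unique_and_separable {X G : Type*}
    (S : GroupoidStr X G) (d : G → ℝ) (hd : IsGroupoidNorm S d) :
    ((∀ (ι : Type) [Nonempty ι] [SemilatticeSup ι] (a : ι → G) (b c : G),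
        SimpleConv S d a b → SimpleConv S d a c → b = c) ↔
      (∀ (ι : Type) [Nonempty ι] [SemilatticeSup ι] (a : ι → G) (b c : G),
        RightConv S d a b → LeftConv S d a c → b = c)) ∧
    ((∀ (ι : Type) [Nonempty ι] [SemilatticeSup ι] (a : ι → G) (b c : G),
        SimpleConv S d a b → SimpleConv S d a c → b = c) → SeparableNorm S d) := by
  have unique_of_simple : (∀ (ι : Type) [Nonempty ι] [SemilatticeSup ι] (a : ι → G) (b c : G),
      SimpleConv S d a b → SimpleConv S d a c → b = c) →
      ∀ (ι : Type) [Nonempty ι] [SemilatticeSup ι] (a : ι → G) (b c : G),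
        RightConv S d a b → LeftConv S d a c → b = c :=
    fun H ι _ _ a b c hb hc => H ι a b c (hb.simpleConv hd) (hc.simpleConv hd)
  refine ⟨⟨unique_of_simple, fun H ι _ _ a b c hb hc => ?_⟩, fun H ι _ _ a x y hx hy ht => ?_⟩
  · obtain ⟨n, hn, hn'⟩ := hb.exists_rightConv_leftConv hd hc
    exact H ι n b c hn hn'
  · have h := unique_of_simple H ι a _ _ (rightConv_unit hx ht) (leftConv_unit hd hy ht)
    rw [← S.src_unit x, h, S.src_unit]
end

section
/- Let (X, d) be a metric space, Γ a commutative group with neutral element 1 endowed with a group homomorphism |·| : Γ → (0, ∞) (into the multiplicative group of positive reals) whose image accumulates at 0 (for every c > 0 there is ε ∈ Γ with |ε| < c). Fix x ∈ X and let δ^x : Γ → (X → X), ε ↦ δ^x_ε, satisfy δ^x_ε ∘ δ^x_μ = δ^x_{εμ} for all ε, μ ∈ Γ. Suppose there is a function d^x : X × X → ℝ such that for all u, v ∈ X, (1/|ε|)·d(δ^x_ε u, δ^x_ε v) converges to d^x(u, v) along the filter |ε| → 0. Then for every μ ∈ Γ and all u, v ∈ X: d^x(δ^x_μ u, δ^x_μ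 v) = |μ|·d^x(u, v) (the limit metric space is a metric cone). -/
/-- Let `(X, d)` be a metric space, `Γ` a commutative group with a
homomorphism `ν = |·|` into the multiplicative group of positive reals whose
image accumulates at `0`, and `δ^x_ε : X → X` a family of maps with
`δ^x_ε ∘ δ^x_μ = δ^x_{εμ}`. If `(1/ν ε) * d (δ^x_ε u, δ^x_ε v)` converges to
`d^x (u, v)` along the filter `ν ε → 0`, then the limit space is a metric
cone: `d^x (δ^x_μ u, δ^x_μ v) = ν μ * d^x (u, v)`. -/
theorem limit_space_is_metric_cone {X : Type*} [MetricSpace X]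
    {Γ : Type*} [CommGroup Γ]
    (ν : Γ → ℝ) (hν_pos : ∀ ε : Γ, 0 < ν ε)
    (hν_mul : ∀ ε μ : Γ, ν (ε * μ) = ν ε * ν μ)
    (hacc : ∀ c : ℝ, 0 < c → ∃ ε : Γ, ν ε < c)
    (x : X) (δ : Γ → X → X)
    (hδ : ∀ (ε μ : Γ) (u : X), δ ε (δ μ u) = δ (ε * μ) u)
    (dx : X → X → ℝ)
    (hlim : ∀ u v : X, ∀ η : ℝ, 0 < η → ∃ c : ℝ, 0 < c ∧
      ∀ ε : Γ, ν ε < c → |(1 / ν ε) * dist (δ ε u) (δ ε v) - dx u v| < η)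
    (μ : Γ) (u v : X) :
    dx (δ μ u) (δ μ v) = ν μ * dx u v := by
  have hμ := hν_pos μ
  refine eq_of_abs_sub_le_all fun η hη => ?_
  obtain ⟨c₁, hc₁, h₁⟩ := hlim (δ μ u) (δ μ v) (η / 2) (by positivity)
  obtain ⟨c₂, hc₂, h₂⟩ := hlim u v (η / 2 / ν μ) (by positivity)
  obtain ⟨ε, hε⟩ := hacc (min c₁ (c₂ / ν μ)) (by positivity)
  obtain ⟨hε₁, hε₂⟩ := lt_min_iff.mp hε
  have hεpos := hν_pos ε
  have hεμ : ν (ε * μ) < c₂ := by rwa [hν_mul, ← lt_div_iff₀ hμ]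
  have h₁' := h₁ ε hε₁
  have h₂' := h₂ (ε * μ) hεμ
  rw [hδ, hδ] at h₁'
  rw [hν_mul, lt_div_iff₀ hμ, mul_comm, ← abs_of_pos hμ, ← abs_mul, abs_of_pos hμ] at h₂'
  have hscale : ν μ * (1 / (ν ε * ν μ) * dist (δ (ε * μ) u) (δ (ε * μ) v) - dx u v) =
      1 / ν ε * dist (δ (ε * μ) u) (δ (ε * μ) v) - ν μ * dx u v := by
    field_simp
  rw [hscale] at h₂'
  rw [abs_lt] at h₁' h₂'
  rw [abs_le]
  constructor <;> linarith
end
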